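/- The space 2^ω with the Besicovitch pseudodistance is path-connected: for all X₀, X₁ ∈ 2^ω there exists a map g : [0,1] → 2^ω with g(0) = X₀, g(1) = X₁, which is continuous with respect to the Besicovitch pseudodistance (i.e., for every r ∈ [0,1] and ε > 0 there is δ > 0 such that |r − r'| < δ implies d(g(r), g(r')) < ε). -/

import Mathlib

open Filter

/-- The Besicovitch pseudodistance on `2^ω`:
`d(X,Y) = limsup_{n→∞} |{m < n : X(m) ≠ Y(m)}|/n`. -/
noncomputable def besic (X Y : ℕ → Bool) : ℝ :=
  Filter.limsup
    (fun n => (((Finset.range n).filter (fun m => X m ≠ Y m)).card : ℝ) / n)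
    Filter.atTop

/-- The dyadic threshold `t n` such that `b(r)(n) = 1 ↔ r ≥ t n`.
It satisfies `t 0 = 1`, `t (2n) = (1 + t n)/2` (for `n ≥ 1`) and `t (2n+1) = t n / 2`. -/
noncomputable def bThresh : ℕ → ℝ
  | 0 => 1
  | (n + 1) =>
      if (n + 1) % 2 = 0 then (1 + bThresh ((n + 1) / 2)) / 2
      else bThresh ((n + 1) / 2) / 2
decreasing_by all_goals exact Nat.div_lt_self (Nat.succ_pos n) one_lt_two

/-- The sequence `b(r) ∈ 2^ω` from the recursion `b(0) = 0^ω`, `b(1) = 1^ω`,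
`b(r) = 0^ω ⊕ b(2r)` for `0 < r ≤ 1/2` and `b(r) = b(2r−1) ⊕ 1^ω` for `1/2 ≤ r < 1`
(each bit is determined at a finite stage; this closed form records precisely the
outcome of that recursion: bit `n` of `b(r)` is `1` iff `r ≥ t n`). -/
noncomputable def bseq (r : ℝ) (n : ℕ) : Bool := decide (bThresh n ≤ r)

/-- Number of ones of `X` among positions `< n`. -/
def onesCount (X : ℕ → Bool) (n : ℕ) : ℕ :=
  ((Finset.range n).filter (fun m => X m = true)).card

theorem bThresh_eq_half (m : ℕ) :
    bThresh m = (bThresh (m / 2) + ((if m % 2 = 0 then 1 else 0 : ℤ) : ℝ)) / 2 := by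
  cases m with
  | zero => simp [bThresh]
  | succ n =>
    rw [bThresh]
    split_ifs <;> push_cast <;> ring

theorem bThresh_mem_Ioc (m : ℕ) : bThresh m ∈ Set.Ioc (0 : ℝ) 1 := by
  induction m using Nat.strong_induction_on with
  | _ m ih =>
    rcases Nat.eq_zero_or_pos m with rfl | hm
    · simp [bThresh]
    · obtain ⟨h0, h1⟩ := ih (m / 2) (Nat.div_lt_self hm one_lt_two)
      rw [bThresh_eq_half]
      constructor <;> split_ifs <;> push_cast <;> linarith

/-- The dyadic interval of length `2⁻ᵏ` containing `bThresh m` determines `m` modulo `2 ^ k`. -/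
theorem modEq_of_ceil_bThresh_eq (k : ℕ) {m n : ℕ}
    (h : ⌈(2 : ℝ) ^ k * bThresh m⌉ = ⌈(2 : ℝ) ^ k * bThresh n⌉) : m ≡ n [MOD 2 ^ k] := by
  induction k generalizing m n with
  | zero => simpa using Nat.modEq_one
  | succ k ih =>
    have ceil_succ (m : ℕ) : ⌈(2 : ℝ) ^ (k + 1) * bThresh m⌉ =
        ⌈(2 : ℝ) ^ k * bThresh (m / 2)⌉ + 2 ^ k * (if m % 2 = 0 then 1 else 0) := by
      rw [bThresh_eq_half m, ← Int.ceil_add_intCast]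
      congr 1
      push_cast
      ring
    have ceil_bounds (m : ℕ) : 0 < ⌈(2 : ℝ) ^ k * bThresh m⌉ ∧
        ⌈(2 : ℝ) ^ k * bThresh m⌉ ≤ 2 ^ k := by
      obtain ⟨h0, h1⟩ := bThresh_mem_Ioc m
      refine ⟨Int.ceil_pos.2 (by positivity), Int.ceil_le.2 ?_⟩
      push_cast
      exact mul_le_of_le_one_right (by positivity) h1
    rw [ceil_succ, ceil_succ] at h
    have hm := ceil_bounds (m / 2)
    have hn := ceil_bounds (n / 2)
    have hpar : m % 2 = n % 2 := by
      split_ifs at h <;> omega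
    rw [hpar] at h
    have hdiv := (ih (add_right_cancel h)).mul_left' 2
    rw [← pow_succ'] at hdiv
    rw [← Nat.div_add_mod m 2, ← Nat.div_add_mod n 2, hpar]
    exact hdiv.add_right _

theorem card_filter_bThresh_mem_Ioc_le (k n : ℕ) {s r : ℝ} (h : r < s + 1 / 2 ^ k) :
    ((Finset.range n).filter (fun m => s < bThresh m ∧ bThresh m ≤ r)).card ≤
      2 * (n / 2 ^ k + 1) := by
  have hcard : (({⌈(2 : ℝ) ^ k * s⌉, ⌈(2 : ℝ) ^ k * s⌉ + 1} : Finset ℤ) ×ˢ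
      Finset.range (n / 2 ^ k + 1)).card = 2 * (n / 2 ^ k + 1) := by
    rw [Finset.card_product, Finset.card_pair (by omega), Finset.card_range]
  rw [← hcard]
  apply Finset.card_le_card_of_injOn (fun m => (⌈(2 : ℝ) ^ k * bThresh m⌉, m / 2 ^ k))
  · intro m hm
    simp only [Finset.coe_filter, Finset.mem_range, Set.mem_ofPred_eq] at hm
    obtain ⟨hmn, hs, hr⟩ := hm
    have hpos : (0 : ℝ) < 2 ^ k := by positivity
    have lower : ⌈(2 : ℝ) ^ k * s⌉ ≤ ⌈(2 : ℝ) ^ k * bThresh m⌉ := by gcongr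
    have upper : ⌈(2 : ℝ) ^ k * bThresh m⌉ ≤ ⌈(2 : ℝ) ^ k * s⌉ + 1 := by
      rw [← Int.ceil_add_one]
      apply Int.ceil_le_ceil
      calc (2 : ℝ) ^ k * bThresh m ≤ 2 ^ k * (s + 1 / 2 ^ k) := by
            gcongr
            exact hr.trans h.le
        _ = 2 ^ k * s + 1 := by field_simp
    have hdiv : m / 2 ^ k ≤ n / 2 ^ k := Nat.div_le_div_right hmn.le
    simp only [Finset.coe_product, Set.mem_prod, Finset.mem_coe, Finset.mem_insert,
      Finset.mem_singleton, Finset.mem_range]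
    omega
  · intro m _ m' _ hmm'
    obtain ⟨hceil, hdiv⟩ := Prod.mk.inj hmm'
    have hmod : m % 2 ^ k = m' % 2 ^ k := modEq_of_ceil_bThresh_eq k hceil
    rw [← Nat.div_add_mod m (2 ^ k), ← Nat.div_add_mod m' (2 ^ k), hdiv, hmod]

theorem besic_comm (X Y : ℕ → Bool) : besic X Y = besic Y X := by
  simp only [besic, ne_comm]

/-- The sequence taking its bits from `X₁` where `bseq r` is one and from `X₀` elsewhere. -/
noncomputable def besicPath (X₀ X₁ : ℕ → Bool) (r : ℝ) (n : ℕ) : Bool :=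
  if bseq r n then X₁ n else X₀ n

theorem besic_besicPath_le (X₀ X₁ : ℕ → Bool) (k : ℕ) {s r : ℝ} (hsr : s ≤ r)
    (h : r < s + 1 / 2 ^ k) :
    besic (besicPath X₀ X₁ s) (besicPath X₀ X₁ r) ≤ 4 / 2 ^ k := by
  apply limsup_le_of_le
  · exact isCoboundedUnder_le_of_le atTop (x := 0) fun n => by positivity
  · filter_upwards [eventually_ge_atTop (2 ^ k)] with n hn
    have hsub : (Finset.range n).filter
          (fun m => besicPath X₀ X₁ s m ≠ besicPath X₀ X₁ r m) ⊆
        (Finset.range n).filter (fun m => s < bThresh m ∧ bThresh m ≤ r) := by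
      refine Finset.monotone_filter_right _ fun m _ hm => ?_
      by_contra hout
      apply hm
      have hiff : bThresh m ≤ s ↔ bThresh m ≤ r :=
        ⟨fun hs => hs.trans hsr, fun hr => not_lt.1 fun hs => hout ⟨hs, hr⟩⟩
      simp [besicPath, bseq, hiff]
    have hcard := (Finset.card_le_card hsub).trans (card_filter_bThresh_mem_Ioc_le k n h)
    have hn' : (2 : ℝ) ^ k ≤ n := by exact_mod_cast hn
    have hpos : (0 : ℝ) < 2 ^ k := by positivity
    have hone : (1 : ℝ) ≤ n / 2 ^ k := (one_le_div hpos).2 hn'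
    have hdiv : ((n / 2 ^ k : ℕ) : ℝ) ≤ n / 2 ^ k := by
      exact_mod_cast (Nat.cast_div_le (m := n) (n := 2 ^ k) (α := ℝ))
    rw [div_le_iff₀ (hpos.trans_le hn')]
    calc _ ≤ ((2 * (n / 2 ^ k + 1) : ℕ) : ℝ) := by exact_mod_cast hcard
      _ = 2 * (((n / 2 ^ k : ℕ) : ℝ) + 1) := by push_cast; ring
      _ ≤ 4 * (n / 2 ^ k) := by linarith
      _ = 4 / 2 ^ k * n := by ring

/-- `2^omega` with the Besicovitch pseudodistance is path-connected. -/
theorem stmt_10 (X₀ X₁ : ℕ → Bool) :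
    ∃ g : ℝ → (ℕ → Bool), g 0 = X₀ ∧ g 1 = X₁ ∧
      ∀ r ∈ Set.Icc (0 : ℝ) 1, ∀ ε > (0 : ℝ), ∃ δ > (0 : ℝ),
        ∀ r' ∈ Set.Icc (0 : ℝ) 1, |r - r'| < δ → besic (g r) (g r') < ε := by
  refine ⟨besicPath X₀ X₁, ?_, ?_, ?_⟩
  · funext n
    simp [besicPath, bseq, (bThresh_mem_Ioc n).1]
  · funext n
    simp [besicPath, bseq, (bThresh_mem_Ioc n).2]
  · intro r _ ε hε
    obtain ⟨k, hk⟩ := exists_pow_lt_of_lt_one (show 0 < ε / 4 by positivity)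
      (show (1 / 2 : ℝ) < 1 by norm_num)
    have hε' : (4 : ℝ) / 2 ^ k < ε := by
      rw [one_div_pow] at hk
      rw [div_eq_mul_one_div]
      linarith
    refine ⟨1 / 2 ^ k, by positivity, fun r' _ hr => ?_⟩
    obtain ⟨hlo, hhi⟩ := abs_lt.1 hr
    rcases le_total r r' with hle | hle
    · exact (besic_besicPath_le X₀ X₁ k hle (by linarith)).trans_lt hε'
    · rw [besic_comm]
      exact (besic_besicPath_le X₀ X₁ k hle (by linarith)).trans_lt hε'
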